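/- The SP semantics induces a bijection between SAND attack trees modulo semantic equivalence and nonempty finite sets of SP graphs: the map sending the equivalence class of a SAND attack tree t (under the relation t ~ t' iff ⟦t⟧ = ⟦t'⟧) to the set ⟦t⟧ is a well-defined bijection from the set of equivalence classes of SAND attack trees onto the collection of nonempty finite sets of SP graphs over 𝔹. -/

import Mathlib

/-!
Formalization of "Attack Trees with Sequential Conjunction".

Source-sink graphs over a set `B` of basic actions: a vertex type `V`,
a multiset of labeled edges, a source `s` and a sink `z` with `s ≠ z`.
-/

structure SSG (B : Type) : Type 1 where
  V : Type
  deq : DecidableEq V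
  E : Multiset (V × B × V)
  s : V
  z : V
  ne : s ≠ z

namespace SSG

variable {B : Type}

/-- The graph with a single edge labeled `b`. -/
def single (b : B) : SSG B where
  V := Bool
  deq := inferInstance
  E := {(false, b, true)}
  s := false
  z := true
  ne := Bool.false_ne_true

/-- In the sequential composition, the sink of the first graph is identified with
the source of the second graph. -/
def seqEmbed (G G' : SSG B) (v : G.V) : ({u : G.V // u ≠ G.z} ⊕ G'.V) :=
  haveI := G.deq
  if h : v = G.z then Sum.inr G'.s else Sum.inl ⟨v, h⟩

/-- Sequential composition `G ⋅ G'` of source-sink graphs: the disjoint union in which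
the sink of `G` is identified with the source of `G'`. -/
def seq (G G' : SSG B) : SSG B where
  V := {u : G.V // u ≠ G.z} ⊕ G'.V
  deq := by haveI := G.deq; haveI := G'.deq; infer_instance
  E := G.E.map (fun e => (G.seqEmbed G' e.1, e.2.1, G.seqEmbed G' e.2.2)) +
       G'.E.map (fun e => (Sum.inr e.1, e.2.1, Sum.inr e.2.2))
  s := Sum.inl ⟨G.s, G.ne⟩
  z := Sum.inr G'.z
  ne := by simp

/-- In the parallel composition, the two sources are identified and the two sinks
are identified. -/
def parEmbed (G G' : SSG B) (v : G.V) : ({u : G.V // u ≠ G.s ∧ u ≠ G.z} ⊕ G'.V) :=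
  haveI := G.deq
  if hs : v = G.s then Sum.inr G'.s
  else if hz : v = G.z then Sum.inr G'.z
  else Sum.inl ⟨v, hs, hz⟩

/-- Parallel composition `G ∥ G'` of source-sink graphs: the disjoint union in which
the two sources are identified and the two sinks are identified. -/
def par (G G' : SSG B) : SSG B where
  V := {u : G.V // u ≠ G.s ∧ u ≠ G.z} ⊕ G'.V
  deq := by haveI := G.deq; haveI := G'.deq; infer_instance
  E := G.E.map (fun e => (G.parEmbed G' e.1, e.2.1, G.parEmbed G' e.2.2)) +
       G'.E.map (fun e => (Sum.inr e.1, e.2.1, Sum.inr e.2.2))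
  s := Sum.inr G'.s
  z := Sum.inr G'.z
  ne := fun h => G'.ne (Sum.inr_injective h)

/-- Two source-sink graphs are equal (isomorphic) if there is a bijection between their
vertex sets that preserves the labeled edges (and hence source and sink). -/
def Iso (G G' : SSG B) : Prop :=
  ∃ f : G.V ≃ G'.V,
    G.E.map (fun e => (f e.1, e.2.1, f e.2.2)) = G'.E ∧ f G.s = G'.s ∧ f G.z = G'.z

/-- Directed adjacency: there is an edge from `u` to `v`. -/
def Adj (G : SSG B) (u v : G.V) : Prop := ∃ b, (u, b, v) ∈ G.E

/-- Series-parallel graphs (SP graphs): built from single edges by sequential and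
parallel composition; as SP graphs are considered up to isomorphism, the collection
is closed under isomorphism. -/
inductive IsSP : SSG B → Prop
  | single (b : B) : IsSP (single b)
  | seq {G G' : SSG B} : IsSP G → IsSP G' → IsSP (G.seq G')
  | par {G G' : SSG B} : IsSP G → IsSP G' → IsSP (G.par G')
  | iso {G G' : SSG B} : IsSP G → G.Iso G' → IsSP G'

/-- A graph is connected if any two vertices are joined by a path in the
underlying undirected graph. -/
def Connected (G : SSG B) : Prop :=
  ∀ u v : G.V, Relation.ReflTransGen (fun a b => G.Adj a b ∨ G.Adj b a) u v

/-- A directed graph is acyclic if it has no (nonempty) directed cycle. -/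
def Acyclic (G : SSG B) : Prop := ∀ v : G.V, ¬ Relation.TransGen G.Adj v v

end SSG
/-!
SAND attack trees: closed terms over `B ∪ {OR, AND, SAND}`, where the unranked
operators take `k ≥ 1` arguments (represented by nonempty lists `SandTreeList`).
-/

mutual
inductive SandTree (B : Type) : Type
  | atom : B → SandTree B
  | or : SandTreeList B → SandTree B
  | and : SandTreeList B → SandTree B
  | sand : SandTreeList B → SandTree B
inductive SandTreeList (B : Type) : Type
  | single : SandTree B → SandTreeList B
  | cons : SandTree B → SandTreeList B → SandTreeList B
end

namespace SandTreeList

variable {B : Type}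

def toList : SandTreeList B → List (SandTree B)
  | .single t => [t]
  | .cons t ts => t :: ts.toList

/-- Prepend a (possibly empty) list of trees to a nonempty argument list. -/
def glue : List (SandTree B) → SandTreeList B → SandTreeList B
  | [], ys => ys
  | x :: xs, ys => .cons x (glue xs ys)

/-- The nonempty argument list `t :: l`. -/
def ofList : SandTree B → List (SandTree B) → SandTreeList B
  | t, [] => .single t
  | t, u :: us => .cons t (ofList u us)

/-- Append a (possibly empty) list of trees to a nonempty argument list. -/
def snoc : SandTreeList B → List (SandTree B) → SandTreeList B
  | .single t, zs => ofList t zs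
  | .cons t ts, zs => .cons t (snoc ts zs)

def map (f : SandTree B → SandTree B) : SandTreeList B → SandTreeList B
  | .single t => .single (f t)
  | .cons t ts => .cons (f t) (map f ts)

end SandTreeList

/-!
The SP semantics `sem` interprets a SAND attack tree as a set of SP graphs
(sets of source-sink graphs closed under isomorphism, since SP graphs are
considered up to isomorphism):
`⟦b⟧ = {→b}`, `⟦OR(t₁,…,t_k)⟧ = ⋃ᵢ ⟦tᵢ⟧`,
`⟦AND(t₁,…,t_k)⟧ = {G₁ ∥ … ∥ G_k | Gᵢ ∈ ⟦tᵢ⟧}`,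
`⟦SAND(t₁,…,t_k)⟧ = {G₁ ⋅ … ⋅ G_k | Gᵢ ∈ ⟦tᵢ⟧}`.
-/

mutual
def sem {B : Type} : SandTree B → Set (SSG B)
  | .atom b => {G | (SSG.single b).Iso G}
  | .or ts => semOr ts
  | .and ts => semAnd ts
  | .sand ts => semSand ts
def semOr {B : Type} : SandTreeList B → Set (SSG B)
  | .single t => sem t
  | .cons t ts => sem t ∪ semOr ts
def semAnd {B : Type} : SandTreeList B → Set (SSG B)
  | .single t => sem t
  | .cons t ts => {G | ∃ G1 ∈ sem t, ∃ G2 ∈ semAnd ts, (G1.par G2).Iso G}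
def semSand {B : Type} : SandTreeList B → Set (SSG B)
  | .single t => sem t
  | .cons t ts => {G | ∃ G1 ∈ sem t, ∃ G2 ∈ semSand ts, (G1.seq G2).Iso G}
end
/-!
Equality of terms modulo commutativity of the unranked operators `OR` and `AND`
(the congruence generated by permuting the arguments of `OR` and `AND` nodes).
-/

mutual
inductive PEq {B : Type} : SandTree B → SandTree B → Prop
  | refl (t : SandTree B) : PEq t t
  | symm {t u : SandTree B} : PEq t u → PEq u t
  | trans {t u v : SandTree B} : PEq t u → PEq u v → PEq t v
  | orPerm {ts ts' : SandTreeList B} : ts.toList.Perm ts'.toList → PEq (.or ts) (.or ts')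
  | andPerm {ts ts' : SandTreeList B} : ts.toList.Perm ts'.toList → PEq (.and ts) (.and ts')
  | orCongr {ts ts' : SandTreeList B} : PEqL ts ts' → PEq (.or ts) (.or ts')
  | andCongr {ts ts' : SandTreeList B} : PEqL ts ts' → PEq (.and ts) (.and ts')
  | sandCongr {ts ts' : SandTreeList B} : PEqL ts ts' → PEq (.sand ts) (.sand ts')
inductive PEqL {B : Type} : SandTreeList B → SandTreeList B → Prop
  | single {t t' : SandTree B} : PEq t t' → PEqL (.single t) (.single t')
  | cons {t t' : SandTree B} {ts ts' : SandTreeList B} :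
      PEq t t' → PEqL ts ts' → PEqL (.cons t ts) (.cons t' ts')
end
/-!
Syntactic consequence from the axiom system `E_SP`.

The axiom schemes are represented by all of their instances (arbitrary argument
terms in place of the variable vectors `X⃗`, `Y⃗`, `Z⃗`); on closed terms this
generates exactly the same derivability relation as variables plus the
substitution rule.  Closure under "replacement in contexts" is represented by
the congruence rules for the three operators.
-/

section
open SandTreeList
mutual
inductive DerivSP {B : Type} : SandTree B → SandTree B → Prop
  /- closure rules -/
  | refl (t : SandTree B) : DerivSP t t
  | symm {t u : SandTree B} : DerivSP t u → DerivSP u t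
  | trans {t u v : SandTree B} : DerivSP t u → DerivSP u v → DerivSP t v
  | congrOr {ts ts' : SandTreeList B} : DerivSPL ts ts' → DerivSP (.or ts) (.or ts')
  | congrAnd {ts ts' : SandTreeList B} : DerivSPL ts ts' → DerivSP (.and ts) (.and ts')
  | congrSand {ts ts' : SandTreeList B} : DerivSPL ts ts' → DerivSP (.sand ts) (.sand ts')
  /- (E1) commutativity of OR -/
  | ax1 {ts ts' : SandTreeList B} : ts.toList.Perm ts'.toList → DerivSP (.or ts) (.or ts')
  /- (E2) commutativity of AND -/
  | ax2 {ts ts' : SandTreeList B} : ts.toList.Perm ts'.toList → DerivSP (.and ts) (.and ts')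
  /- (E3) OR(X⃗, OR(Y⃗)) = OR(X⃗, Y⃗) -/
  | ax3 (xs : List (SandTree B)) (ys : SandTreeList B) :
      DerivSP (.or (glue xs (.single (.or ys)))) (.or (glue xs ys))
  /- (E4) AND(X⃗, AND(Y⃗)) = AND(X⃗, Y⃗) -/
  | ax4 (xs : List (SandTree B)) (ys : SandTreeList B) :
      DerivSP (.and (glue xs (.single (.and ys)))) (.and (glue xs ys))
  /- (E4') SAND(X⃗, SAND(Y⃗), Z⃗) = SAND(X⃗, Y⃗, Z⃗) -/
  | ax4' (xs : List (SandTree B)) (ys : SandTreeList B) (zs : List (SandTree B)) :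
      DerivSP (.sand (glue xs (snoc (.single (.sand ys)) zs))) (.sand (glue xs (snoc ys zs)))
  /- (E5) OR(A) = A -/
  | ax5 (t : SandTree B) : DerivSP (.or (.single t)) t
  /- (E6) AND(A) = A -/
  | ax6 (t : SandTree B) : DerivSP (.and (.single t)) t
  /- (E6') SAND(A) = A -/
  | ax6' (t : SandTree B) : DerivSP (.sand (.single t)) t
  /- (E10) AND(X⃗, OR(Y⃗)) = OR(AND(X⃗,Y₁),…,AND(X⃗,Yₗ)) -/
  | ax10 (xs : List (SandTree B)) (ys : SandTreeList B) :
      DerivSP (.and (glue xs (.single (.or ys))))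
        (.or (SandTreeList.map (fun y => .and (glue xs (.single y))) ys))
  /- (E10') SAND(X⃗, OR(Y⃗), Z⃗) = OR(SAND(X⃗,Y₁,Z⃗),…,SAND(X⃗,Yₗ,Z⃗)) -/
  | ax10' (xs : List (SandTree B)) (ys : SandTreeList B) (zs : List (SandTree B)) :
      DerivSP (.sand (glue xs (snoc (.single (.or ys)) zs)))
        (.or (SandTreeList.map (fun y => .sand (glue xs (snoc (.single y) zs))) ys))
  /- (E11) OR(A, A, X⃗) = OR(A, X⃗) -/
  | ax11 (a : SandTree B) (xs : List (SandTree B)) :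
      DerivSP (.or (.cons a (ofList a xs))) (.or (ofList a xs))
inductive DerivSPL {B : Type} : SandTreeList B → SandTreeList B → Prop
  | single {t t' : SandTree B} : DerivSP t t' → DerivSPL (.single t) (.single t')
  | cons {t t' : SandTree B} {ts ts' : SandTreeList B} :
      DerivSP t t' → DerivSPL ts ts' → DerivSPL (.cons t ts) (.cons t' ts')
end
end

/-! Syntactic consequence from the SAND-free fragment
`E_SM = {E1, E2, E3, E4, E5, E6, E10, E11}` of `E_SP` (formulated over the full
signature of SAND attack trees). -/
section
open SandTreeList
mutual
inductive DerivSM {B : Type} : SandTree B → SandTree B → Prop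
  | refl (t : SandTree B) : DerivSM t t
  | symm {t u : SandTree B} : DerivSM t u → DerivSM u t
  | trans {t u v : SandTree B} : DerivSM t u → DerivSM u v → DerivSM t v
  | congrOr {ts ts' : SandTreeList B} : DerivSML ts ts' → DerivSM (.or ts) (.or ts')
  | congrAnd {ts ts' : SandTreeList B} : DerivSML ts ts' → DerivSM (.and ts) (.and ts')
  | congrSand {ts ts' : SandTreeList B} : DerivSML ts ts' → DerivSM (.sand ts) (.sand ts')
  | ax1 {ts ts' : SandTreeList B} : ts.toList.Perm ts'.toList → DerivSM (.or ts) (.or ts')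
  | ax2 {ts ts' : SandTreeList B} : ts.toList.Perm ts'.toList → DerivSM (.and ts) (.and ts')
  | ax3 (xs : List (SandTree B)) (ys : SandTreeList B) :
      DerivSM (.or (glue xs (.single (.or ys)))) (.or (glue xs ys))
  | ax4 (xs : List (SandTree B)) (ys : SandTreeList B) :
      DerivSM (.and (glue xs (.single (.and ys)))) (.and (glue xs ys))
  | ax5 (t : SandTree B) : DerivSM (.or (.single t)) t
  | ax6 (t : SandTree B) : DerivSM (.and (.single t)) t
  | ax10 (xs : List (SandTree B)) (ys : SandTreeList B) :
      DerivSM (.and (glue xs (.single (.or ys))))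
        (.or (SandTreeList.map (fun y => .and (glue xs (.single y))) ys))
  | ax11 (a : SandTree B) (xs : List (SandTree B)) :
      DerivSM (.or (.cons a (ofList a xs))) (.or (ofList a xs))
inductive DerivSML {B : Type} : SandTreeList B → SandTreeList B → Prop
  | single {t t' : SandTree B} : DerivSM t t' → DerivSML (.single t) (.single t')
  | cons {t t' : SandTree B} {ts ts' : SandTreeList B} :
      DerivSM t t' → DerivSML ts ts' → DerivSML (.cons t ts) (.cons t' ts')
end
end
/-!
The normal-form grammar (for `k ≥ 2`, `b ∈ B`):
`N ::= A | OR(A₁,…,A_k)` (with pairwise distinct `Aᵢ`),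
`A ::= C | S`, `C ::= b | AND(S₁,…,S_k)`, `S ::= b | SAND(C₁,…,C_k)`.
-/

mutual
inductive IsC {B : Type} : SandTree B → Prop
  | atom (b : B) : IsC (.atom b)
  | and {ts : SandTreeList B} : 2 ≤ ts.toList.length → IsSL ts → IsC (.and ts)
inductive IsS {B : Type} : SandTree B → Prop
  | atom (b : B) : IsS (.atom b)
  | sand {ts : SandTreeList B} : 2 ≤ ts.toList.length → IsCL ts → IsS (.sand ts)
inductive IsSL {B : Type} : SandTreeList B → Prop
  | single {t : SandTree B} : IsS t → IsSL (.single t)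
  | cons {t : SandTree B} {ts : SandTreeList B} : IsS t → IsSL ts → IsSL (.cons t ts)
inductive IsCL {B : Type} : SandTreeList B → Prop
  | single {t : SandTree B} : IsC t → IsCL (.single t)
  | cons {t : SandTree B} {ts : SandTreeList B} : IsC t → IsCL ts → IsCL (.cons t ts)
end

/-- Terms generated by the non-terminal `A` of the normal-form grammar. -/
def IsA {B : Type} (t : SandTree B) : Prop := IsC t ∨ IsS t

/-- Terms generated by the non-terminal `N` of the normal-form grammar; as terms
are considered modulo commutativity of `OR` and `AND`, the arguments of the `OR`
are required to be pairwise distinct modulo commutativity. -/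
def IsN {B : Type} (t : SandTree B) : Prop :=
  IsA t ∨ ∃ ts : SandTreeList B, t = .or ts ∧ 2 ≤ ts.toList.length ∧
    (∀ u ∈ ts.toList, IsA u) ∧ ts.toList.Pairwise (fun a b => ¬ PEq a b)

/-!
The term rewriting system obtained by orienting the axioms
(E3), (E4), (E4'), (E5), (E6), (E6'), (E10), (E10'), (E11) from left to right,
applied in any context, modulo commutativity of `OR` and `AND`.
-/

section
open SandTreeList

/-- Rule application at the root. -/
inductive RStep {B : Type} : SandTree B → SandTree B → Prop
  | r3 (xs : List (SandTree B)) (ys : SandTreeList B) :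
      RStep (.or (glue xs (.single (.or ys)))) (.or (glue xs ys))
  | r4 (xs : List (SandTree B)) (ys : SandTreeList B) :
      RStep (.and (glue xs (.single (.and ys)))) (.and (glue xs ys))
  | r4' (xs : List (SandTree B)) (ys : SandTreeList B) (zs : List (SandTree B)) :
      RStep (.sand (glue xs (snoc (.single (.sand ys)) zs))) (.sand (glue xs (snoc ys zs)))
  | r5 (t : SandTree B) : RStep (.or (.single t)) t
  | r6 (t : SandTree B) : RStep (.and (.single t)) t
  | r6' (t : SandTree B) : RStep (.sand (.single t)) t
  | r10 (xs : List (SandTree B)) (ys : SandTreeList B) :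
      RStep (.and (glue xs (.single (.or ys))))
        (.or (SandTreeList.map (fun y => .and (glue xs (.single y))) ys))
  | r10' (xs : List (SandTree B)) (ys : SandTreeList B) (zs : List (SandTree B)) :
      RStep (.sand (glue xs (snoc (.single (.or ys)) zs)))
        (.or (SandTreeList.map (fun y => .sand (glue xs (snoc (.single y) zs))) ys))
  | r11 (a : SandTree B) (xs : List (SandTree B)) :
      RStep (.or (.cons a (ofList a xs))) (.or (ofList a xs))

end

/-! Rule application in an arbitrary context. -/
mutual
inductive Rw {B : Type} : SandTree B → SandTree B → Prop
  | root {t t' : SandTree B} : RStep t t' → Rw t t'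
  | or {ts ts' : SandTreeList B} : RwL ts ts' → Rw (.or ts) (.or ts')
  | and {ts ts' : SandTreeList B} : RwL ts ts' → Rw (.and ts) (.and ts')
  | sand {ts ts' : SandTreeList B} : RwL ts ts' → Rw (.sand ts) (.sand ts')
inductive RwL {B : Type} : SandTreeList B → SandTreeList B → Prop
  | single {t t' : SandTree B} : Rw t t' → RwL (.single t) (.single t')
  | head {t t' : SandTree B} {ts : SandTreeList B} : Rw t t' → RwL (.cons t ts) (.cons t' ts)
  | tail {t : SandTree B} {ts ts' : SandTreeList B} : RwL ts ts' → RwL (.cons t ts) (.cons t ts')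
end

/-- One rewrite step of the TRS `⇒`, working modulo commutativity of `OR` and `AND`. -/
def RwMod {B : Type} (t t' : SandTree B) : Prop :=
  ∃ u u' : SandTree B, PEq t u ∧ Rw u u' ∧ PEq u' t'

/-- Zero or more rewrite steps (modulo commutativity of `OR` and `AND`). -/
def RwStar {B : Type} : SandTree B → SandTree B → Prop :=
  Relation.ReflTransGen (fun a b => PEq a b ∨ Rw a b)

/-- A normal form: no rewrite rule is applicable, modulo commutativity of `OR` and `AND`. -/
def NormalForm {B : Type} (t : SandTree B) : Prop :=
  ∀ u t' : SandTree B, PEq t u → ¬ Rw u t'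

/-! The norm `‖·‖`: `‖b‖ = 1`, `‖OR(t₁,…,t_k)‖ = ‖t₁‖+…+‖t_k‖+2`,
`‖AND(t₁,…,t_k)‖ = ‖SAND(t₁,…,t_k)‖ = 2·‖t₁‖·…·‖t_k‖`. -/
mutual
def weight {B : Type} : SandTree B → ℕ
  | .atom _ => 1
  | .or ts => weightSum ts + 2
  | .and ts => 2 * weightProd ts
  | .sand ts => 2 * weightProd ts
def weightSum {B : Type} : SandTreeList B → ℕ
  | .single t => weight t
  | .cons t ts => weight t + weightSum ts
def weightProd {B : Type} : SandTreeList B → ℕ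
  | .single t => weight t
  | .cons t ts => weight t * weightProd ts
end
/-!
Standard attack trees are SAND attack trees containing no `SAND` operator.
The multiset semantics maps a standard attack tree to a set of finite multisets
over `B`: `⟦b⟧_M = {⟨b⟩}`, `⟦OR⟧_M = ⋃ᵢ ⟦tᵢ⟧_M`,
`⟦AND⟧_M = {M₁ ⊎ … ⊎ M_k | Mᵢ ∈ ⟦tᵢ⟧_M}`.
(Its value on trees containing `SAND` is irrelevant and set to `∅`.)
-/

mutual
inductive NoSand {B : Type} : SandTree B → Prop
  | atom (b : B) : NoSand (.atom b)
  | or {ts : SandTreeList B} : NoSandL ts → NoSand (.or ts)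
  | and {ts : SandTreeList B} : NoSandL ts → NoSand (.and ts)
inductive NoSandL {B : Type} : SandTreeList B → Prop
  | single {t : SandTree B} : NoSand t → NoSandL (.single t)
  | cons {t : SandTree B} {ts : SandTreeList B} : NoSand t → NoSandL ts → NoSandL (.cons t ts)
end

mutual
def msem {B : Type} : SandTree B → Set (Multiset B)
  | .atom b => {({b} : Multiset B)}
  | .or ts => msemOr ts
  | .and ts => msemAnd ts
  | .sand _ => ∅
def msemOr {B : Type} : SandTreeList B → Set (Multiset B)
  | .single t => msem t
  | .cons t ts => msem t ∪ msemOr ts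
def msemAnd {B : Type} : SandTreeList B → Set (Multiset B)
  | .single t => msem t
  | .cons t ts => {M | ∃ M1 ∈ msem t, ∃ M2 ∈ msemAnd ts, M = M1 + M2}
end

/-- Parallel composition of a nonempty list of graphs `G ∥ H₁ ∥ … ∥ H_k`. -/
def parAll {B : Type} : SSG B → List (SSG B) → SSG B
  | G, [] => G
  | G, H :: Hs => parAll (G.par H) Hs

/-- SAND attack trees modulo equivalence with respect to the SP semantics
(`t ~ t'` iff `⟦t⟧ = ⟦t'⟧`). -/
def semSetoid (B : Type) : Setoid (SandTree B) :=
  ⟨fun t t' => sem t = sem t', fun _ => rfl, Eq.symm, Eq.trans⟩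

/-- The map induced by the SP semantics on equivalence classes of SAND attack trees. -/
def semClass {B : Type} : Quotient (semSetoid B) → Set (SSG B) :=
  Quotient.lift sem (fun _ _ h => h)

/-!
Bottom-up evaluation of the minimal attack time attribute on SAND attack trees:
`α(b) = β(b)`, `α(OR) = min`, `α(AND) = max`, `α(SAND) = Σ`.
-/

mutual
def attr {B : Type} (β : B → NNReal) : SandTree B → NNReal
  | .atom b => β b
  | .or ts => attrOr β ts
  | .and ts => attrAnd β ts
  | .sand ts => attrSand β ts
def attrOr {B : Type} (β : B → NNReal) : SandTreeList B → NNReal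
  | .single t => attr β t
  | .cons t ts => min (attr β t) (attrOr β ts)
def attrAnd {B : Type} (β : B → NNReal) : SandTreeList B → NNReal
  | .single t => attr β t
  | .cons t ts => max (attr β t) (attrAnd β ts)
def attrSand {B : Type} (β : B → NNReal) : SandTreeList B → NNReal
  | .single t => attr β t
  | .cons t ts => attr β t + attrSand β ts
end
/-!
Standard attack trees as a standalone signature (`B ∪ {OR, AND}`, unranked
operators with `k ≥ 1` arguments), their multiset semantics, and syntactic
consequence from the axiom system `E_SM`.
-/

mutual
inductive ATree (B : Type) : Type
  | atom : B → ATree B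
  | or : ATreeList B → ATree B
  | and : ATreeList B → ATree B
inductive ATreeList (B : Type) : Type
  | single : ATree B → ATreeList B
  | cons : ATree B → ATreeList B → ATreeList B
end

namespace ATreeList

variable {B : Type}

def toList : ATreeList B → List (ATree B)
  | .single t => [t]
  | .cons t ts => t :: ts.toList

def glue : List (ATree B) → ATreeList B → ATreeList B
  | [], ys => ys
  | x :: xs, ys => .cons x (glue xs ys)

def ofList : ATree B → List (ATree B) → ATreeList B
  | t, [] => .single t
  | t, u :: us => .cons t (ofList u us)

def map (f : ATree B → ATree B) : ATreeList B → ATreeList B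
  | .single t => .single (f t)
  | .cons t ts => .cons (f t) (map f ts)

end ATreeList

/-! The multiset semantics of standard attack trees. -/

mutual
def amsem {B : Type} : ATree B → Set (Multiset B)
  | .atom b => {({b} : Multiset B)}
  | .or ts => amsemOr ts
  | .and ts => amsemAnd ts
def amsemOr {B : Type} : ATreeList B → Set (Multiset B)
  | .single t => amsem t
  | .cons t ts => amsem t ∪ amsemOr ts
def amsemAnd {B : Type} : ATreeList B → Set (Multiset B)
  | .single t => amsem t
  | .cons t ts => {M | ∃ M1 ∈ amsem t, ∃ M2 ∈ amsemAnd ts, M = M1 + M2}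
end

/-!
Syntactic consequence from `E_SM = {E1, E2, E3, E4, E5, E6, E10, E11}`.
Axiom schemes are represented by all of their instances (closure under
substitution is then automatic), and closure under replacement in contexts is
represented by the congruence rules.
-/

section
open ATreeList
mutual
inductive DerivASM {B : Type} : ATree B → ATree B → Prop
  | refl (t : ATree B) : DerivASM t t
  | symm {t u : ATree B} : DerivASM t u → DerivASM u t
  | trans {t u v : ATree B} : DerivASM t u → DerivASM u v → DerivASM t v
  | congrOr {ts ts' : ATreeList B} : DerivASML ts ts' → DerivASM (.or ts) (.or ts')
  | congrAnd {ts ts' : ATreeList B} : DerivASML ts ts' → DerivASM (.and ts) (.and ts')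
  /- (E1) -/
  | ax1 {ts ts' : ATreeList B} : ts.toList.Perm ts'.toList → DerivASM (.or ts) (.or ts')
  /- (E2) -/
  | ax2 {ts ts' : ATreeList B} : ts.toList.Perm ts'.toList → DerivASM (.and ts) (.and ts')
  /- (E3) -/
  | ax3 (xs : List (ATree B)) (ys : ATreeList B) :
      DerivASM (.or (glue xs (.single (.or ys)))) (.or (glue xs ys))
  /- (E4) -/
  | ax4 (xs : List (ATree B)) (ys : ATreeList B) :
      DerivASM (.and (glue xs (.single (.and ys)))) (.and (glue xs ys))
  /- (E5) -/
  | ax5 (t : ATree B) : DerivASM (.or (.single t)) t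
  /- (E6) -/
  | ax6 (t : ATree B) : DerivASM (.and (.single t)) t
  /- (E10) -/
  | ax10 (xs : List (ATree B)) (ys : ATreeList B) :
      DerivASM (.and (glue xs (.single (.or ys))))
        (.or (ATreeList.map (fun y => .and (glue xs (.single y))) ys))
  /- (E11) -/
  | ax11 (a : ATree B) (xs : List (ATree B)) :
      DerivASM (.or (.cons a (ofList a xs))) (.or (ofList a xs))
inductive DerivASML {B : Type} : ATreeList B → ATreeList B → Prop
  | single {t t' : ATree B} : DerivASM t t' → DerivASML (.single t) (.single t')
  | cons {t t' : ATree B} {ts ts' : ATreeList B} :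
      DerivASM t t' → DerivASML ts ts' → DerivASML (.cons t ts) (.cons t' ts')
end
end
namespace SSG

variable {B : Type}

theorem Iso.refl (G : SSG B) : G.Iso G := ⟨Equiv.refl _, by simp, rfl, rfl⟩

theorem Iso.symm {G H : SSG B} : G.Iso H → H.Iso G := by
  rintro ⟨f, hE, hs, hz⟩
  refine ⟨f.symm, ?_, by simp [← hs], by simp [← hz]⟩
  simp [← hE, Multiset.map_map]

theorem Iso.trans {G H K : SSG B} : G.Iso H → H.Iso K → G.Iso K := by
  rintro ⟨f, hE, hs, hz⟩ ⟨g, hE', hs', hz'⟩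
  refine ⟨f.trans g, ?_, by simp [hs, hs'], by simp [hz, hz']⟩
  simp [← hE', ← hE, Multiset.map_map]

theorem Iso.seq {G G' H H' : SSG B} : G.Iso G' → H.Iso H' → (G.seq H).Iso (G'.seq H') := by
  rintro ⟨f, hE, hs, hz⟩ ⟨g, hE', hs', hz'⟩
  have hf : ∀ v, v ≠ G.z ↔ f v ≠ G'.z := fun v => by rw [← hz, Ne, Ne, f.apply_eq_iff_eq]
  let φ : {u // u ≠ G.z} ⊕ H.V ≃ {u // u ≠ G'.z} ⊕ H'.V := (f.subtypeEquiv hf).sumCongr g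
  have hl : ∀ v, φ (G.seqEmbed H v) = G'.seqEmbed H' (f v) := by
    intro v
    by_cases h : v = G.z
    · simp [φ, seqEmbed, h, hz, hs']
    · have h' := (hf v).1 h
      simp [φ, seqEmbed, h, h']
  have hr : ∀ v, φ (Sum.inr v) = Sum.inr (g v) := fun v => rfl
  refine ⟨φ, ?_, congrArg Sum.inl (Subtype.ext hs), congrArg Sum.inr hz'⟩
  change Multiset.map (fun e : (_ ⊕ H.V) × B × (_ ⊕ H.V) => (φ e.1, e.2.1, φ e.2.2)) (_ + _) = _ + _
  simp [← hE, ← hE', Multiset.map_map, hl, hr]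

theorem Iso.par {G G' H H' : SSG B} : G.Iso G' → H.Iso H' → (G.par H).Iso (G'.par H') := by
  rintro ⟨f, hE, hs, hz⟩ ⟨g, hE', hs', hz'⟩
  have hfs : ∀ v, v ≠ G.s ↔ f v ≠ G'.s := fun v => by rw [← hs, Ne, Ne, f.apply_eq_iff_eq]
  have hfz : ∀ v, v ≠ G.z ↔ f v ≠ G'.z := fun v => by rw [← hz, Ne, Ne, f.apply_eq_iff_eq]
  let φ : {u // u ≠ G.s ∧ u ≠ G.z} ⊕ H.V ≃ {u // u ≠ G'.s ∧ u ≠ G'.z} ⊕ H'.V :=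
    (f.subtypeEquiv fun v => and_congr (hfs v) (hfz v)).sumCongr g
  have hl : ∀ v, φ (G.parEmbed H v) = G'.parEmbed H' (f v) := by
    intro v
    by_cases h : v = G.s
    · simp [φ, parEmbed, h, hs, hs']
    · have h' := (hfs v).1 h
      by_cases k : v = G.z
      · simp [φ, parEmbed, k, hz, hz', G.ne.symm, G'.ne.symm]
      · have k' := (hfz v).1 k
        simp [φ, parEmbed, h, h', k, k']
  have hr : ∀ v, φ (Sum.inr v) = Sum.inr (g v) := fun v => rfl
  refine ⟨φ, ?_, congrArg Sum.inr hs', congrArg Sum.inr hz'⟩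
  change Multiset.map (fun e : (_ ⊕ H.V) × B × (_ ⊕ H.V) => (φ e.1, e.2.1, φ e.2.2)) (_ + _) = _ + _
  simp [← hE, ← hE', Multiset.map_map, hl, hr]

/-- The set of graphs is represented by a nonempty finite list of SP graphs. -/
def IsFiniteSP (S : Set (SSG B)) : Prop :=
  ∃ Gs : List (SSG B), Gs ≠ [] ∧ (∀ G ∈ Gs, IsSP G) ∧ S = {H | ∃ G ∈ Gs, G.Iso H}

theorem IsFiniteSP.single (b : B) : IsFiniteSP {G | (SSG.single b).Iso G} :=
  ⟨[SSG.single b], by simp, by simpa using IsSP.single b, by simp⟩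

theorem IsFiniteSP.union {S T : Set (SSG B)} :
    IsFiniteSP S → IsFiniteSP T → IsFiniteSP (S ∪ T) := by
  rintro ⟨Gs, h0, hG, rfl⟩ ⟨Hs, -, hH, rfl⟩
  refine ⟨Gs ++ Hs, by simp [h0], ?_, ?_⟩
  · intro K hK
    exact (List.mem_append.1 hK).elim (hG K) (hH K)
  · ext K
    simp [or_and_right, exists_or]

theorem IsFiniteSP.image2 {S T : Set (SSG B)} (op : SSG B → SSG B → SSG B)
    (hiso : ∀ {G G' H H'}, G.Iso G' → H.Iso H' → (op G H).Iso (op G' H'))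
    (hsp : ∀ {G H}, IsSP G → IsSP H → IsSP (op G H)) :
    IsFiniteSP S → IsFiniteSP T →
      IsFiniteSP {K | ∃ G ∈ S, ∃ H ∈ T, (op G H).Iso K} := by
  rintro ⟨Gs, h0, hG, rfl⟩ ⟨Hs, h0', hH, rfl⟩
  obtain ⟨G₀, hG₀⟩ := List.exists_mem_of_ne_nil Gs h0
  obtain ⟨H₀, hH₀⟩ := List.exists_mem_of_ne_nil Hs h0'
  refine ⟨Gs.flatMap fun G => Hs.map (op G), ?_, ?_, ?_⟩
  · exact List.ne_nil_of_mem
      (List.mem_flatMap.2 ⟨G₀, hG₀, List.mem_map.2 ⟨H₀, hH₀, rfl⟩⟩)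
  · intro K hK
    obtain ⟨G, hGm, hK⟩ := List.mem_flatMap.1 hK
    obtain ⟨H, hHm, rfl⟩ := List.mem_map.1 hK
    exact hsp (hG G hGm) (hH H hHm)
  · ext K
    constructor
    · rintro ⟨G', ⟨G, hGm, hGi⟩, H', ⟨H, hHm, hHi⟩, hK⟩
      exact ⟨op G H, List.mem_flatMap.2 ⟨G, hGm, List.mem_map.2 ⟨H, hHm, rfl⟩⟩,
        (hiso hGi hHi).trans hK⟩
    · rintro ⟨L, hL, hK⟩
      obtain ⟨G, hGm, hL⟩ := List.mem_flatMap.1 hL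
      obtain ⟨H, hHm, rfl⟩ := List.mem_map.1 hL
      exact ⟨G, ⟨G, hGm, .refl G⟩, H, ⟨H, hHm, .refl H⟩, hK⟩

theorem setOf_exists_iso_op (op : SSG B → SSG B → SSG B)
    (hiso : ∀ {G G' H H'}, G.Iso G' → H.Iso H' → (op G H).Iso (op G' H')) (G H : SSG B) :
    {K | ∃ G' ∈ {G' | G.Iso G'}, ∃ H' ∈ {H' | H.Iso H'}, (op G' H').Iso K} =
      {K | (op G H).Iso K} := by
  ext K
  constructor
  · rintro ⟨G', hG, H', hH, hK⟩
    exact (hiso hG hH).trans hK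
  · exact fun hK => ⟨G, .refl G, H, .refl H, hK⟩

theorem IsSP.exists_sem_eq {G : SSG B} (hG : IsSP G) :
    ∃ t : SandTree B, sem t = {H | G.Iso H} := by
  induction hG with
  | single b => exact ⟨.atom b, by simp [sem]⟩
  | @seq G H _ _ ihG ihH =>
    obtain ⟨t, ht⟩ := ihG
    obtain ⟨u, hu⟩ := ihH
    refine ⟨.sand (.cons t (.single u)), ?_⟩
    simp only [sem, semSand, ht, hu]
    exact setOf_exists_iso_op SSG.seq Iso.seq G H
  | @par G H _ _ ihG ihH =>
    obtain ⟨t, ht⟩ := ihG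
    obtain ⟨u, hu⟩ := ihH
    refine ⟨.and (.cons t (.single u)), ?_⟩
    simp only [sem, semAnd, ht, hu]
    exact setOf_exists_iso_op SSG.par Iso.par G H
  | iso _ h ih =>
    obtain ⟨t, ht⟩ := ih
    refine ⟨t, ht.trans ?_⟩
    ext K
    exact ⟨h.symm.trans, h.trans⟩

theorem exists_sem_eq_of_list (Gs : List (SSG B)) (h0 : Gs ≠ []) (hG : ∀ G ∈ Gs, IsSP G) :
    ∃ t : SandTree B, sem t = {H | ∃ G ∈ Gs, G.Iso H} := by
  induction Gs with
  | nil => exact absurd rfl h0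
  | cons G Gs ih =>
    obtain ⟨t, ht⟩ := (hG G (by simp)).exists_sem_eq
    by_cases h : Gs = []
    · exact ⟨t, by simp [ht, h]⟩
    · obtain ⟨u, hu⟩ := ih h fun K hK => hG K (List.mem_cons_of_mem _ hK)
      refine ⟨.or (.cons t (.single u)), ?_⟩
      ext K
      simp [sem, semOr, ht, hu]

end SSG

mutual
theorem isFiniteSP_sem {B : Type} : ∀ t : SandTree B, SSG.IsFiniteSP (sem t)
  | .atom b => by simpa only [sem] using SSG.IsFiniteSP.single b
  | .or ts => by simpa only [sem] using (isFiniteSP_semList ts).1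
  | .and ts => by simpa only [sem] using (isFiniteSP_semList ts).2.1
  | .sand ts => by simpa only [sem] using (isFiniteSP_semList ts).2.2
theorem isFiniteSP_semList {B : Type} : ∀ ts : SandTreeList B,
    SSG.IsFiniteSP (semOr ts) ∧ SSG.IsFiniteSP (semAnd ts) ∧ SSG.IsFiniteSP (semSand ts)
  | .single t => by simpa only [semOr, semAnd, semSand, and_self] using isFiniteSP_sem t
  | .cons t ts => by
    have ht := isFiniteSP_sem t
    obtain ⟨h1, h2, h3⟩ := isFiniteSP_semList ts
    simp only [semOr, semAnd, semSand]
    exact ⟨ht.union h1, ht.image2 SSG.par SSG.Iso.par SSG.IsSP.par h2,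
      ht.image2 SSG.seq SSG.Iso.seq SSG.IsSP.seq h3⟩
end

/-- The map sending the equivalence class of a SAND attack tree
`t` (under `t ~ t'` iff `⟦t⟧ = ⟦t'⟧`) to `⟦t⟧` is a well-defined bijection from
equivalence classes of SAND attack trees onto the collection of nonempty finite
sets of SP graphs (represented by isomorphism-closures of nonempty finite lists
of SP graphs). -/
theorem semClass_bijective (B : Type) :
    Function.Injective (semClass (B := B)) ∧
    Set.range (semClass (B := B)) =
      {S : Set (SSG B) | ∃ Gs : List (SSG B), Gs ≠ [] ∧ (∀ G ∈ Gs, SSG.IsSP G) ∧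
        S = {H | ∃ G ∈ Gs, G.Iso H}} := by
  refine ⟨?_, ?_⟩
  · rintro ⟨t⟩ ⟨u⟩ h
    exact Quotient.sound h
  · ext S
    constructor
    · rintro ⟨⟨t⟩, rfl⟩
      exact isFiniteSP_sem t
    · rintro ⟨Gs, h0, hG, rfl⟩
      obtain ⟨t, ht⟩ := SSG.exists_sem_eq_of_list Gs h0 hG
      exact ⟨Quotient.mk _ t, ht⟩
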